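/- arXiv:1007.5508 — 5 statements merged into one kernel-verified Lean document; each statement's English description precedes it below -/
import Mathlib

section
/- For all integers i, j with 1 ≤ i ≤ j ≤ n−1, the following identity holds in Q_f: ζ_i ζ_j = −Σ_{k = max(i+j−n, 1)}^{i} f_{i+j−k} ζ_k + Σ_{k = j+1}^{min(i+j, n)} f_{i+j−k} ζ_k, where by convention ζ_n := −f_n (an element of Q_f). -/
open Polynomial

noncomputable section

/-- The polynomial `f₀ Tⁿ + f₁ Tⁿ⁻¹ + ⋯ + fₙ` over `ℚ`. -/
def fpoly (n : ℕ) (f : ℕ → ℤ) : Polynomial ℚ :=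
  ∑ i ∈ Finset.range (n + 1), Polynomial.C (f i : ℚ) * Polynomial.X ^ (n - i)

/-- `Q_f = ℚ[T]/(f₀ Tⁿ + ⋯ + fₙ)`. -/
abbrev Qf (n : ℕ) (f : ℕ → ℤ) := AdjoinRoot (fpoly n f)

/-- `θ`, the image of `T` in `Q_f`. -/
def th (n : ℕ) (f : ℕ → ℤ) : Qf n f := AdjoinRoot.root _

/-- `ζ₀ = 1`, and `ζ_k = f₀ θ^k + f₁ θ^(k-1) + ⋯ + f_(k-1) θ` for `k ≥ 1`. -/
def zeta (n : ℕ) (f : ℕ → ℤ) (k : ℕ) : Qf n f :=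
  if k = 0 then 1 else ∑ i ∈ Finset.range k, (f i : Qf n f) * th n f ^ (k - i)

/-- `ζ_k` extended by the convention `ζ_n := -f_n`. -/
def zetaExt (n : ℕ) (f : ℕ → ℤ) (k : ℕ) : Qf n f :=
  if k = n then -(f n : Qf n f) else zeta n f k

/-- The product formula for a sequence satisfying the Horner recursion `z (k + 1) = t (z k + F k)`
with `z 0 = 0`. -/
theorem horner_mul_horner {R : Type*} [CommRing R] (t : R) (F z : ℕ → R) (h0 : z 0 = 0)
    (hz : ∀ k, z (k + 1) = t * (z k + F k)) (i j : ℕ) :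
    z i * z j = -(∑ k ∈ Finset.Ico 1 (i + 1), F (i + j - k) * z k)
      + ∑ k ∈ Finset.Ico (j + 1) (i + j + 1), F (i + j - k) * z k := by
  induction i generalizing j with
  | zero => simp [h0]
  | succ i ih =>
    have hstep : z (i + 1) * z j = z i * z (j + 1) - F j * z (i + 1) + F i * z (j + 1) := by
      rw [hz i, hz j]; ring
    have e1 : i + 1 + j = i + (j + 1) := by omega
    have e2 : i + (j + 1) - (i + 1) = j := by omega
    have e3 : i + (j + 1) - (j + 1) = i := by omega
    rw [hstep, ih (j + 1), Finset.sum_Ico_succ_top (by omega : 1 ≤ i + 1), e1,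
      Finset.sum_eq_sum_Ico_succ_bot (by omega : j + 1 < i + (j + 1) + 1), e2, e3]
    ring

/-- The coefficients of `f`, extended by zero beyond degree `n`, in `Q_f`. -/
def truncCoeff (n : ℕ) (f : ℕ → ℤ) (k : ℕ) : Qf n f := if k ≤ n then (f k : Qf n f) else 0

/-- The sums `f₀ θ^k + ⋯ + f_(k-1) θ` for all `k`, with `f` extended by zero. -/
def hornerSum (n : ℕ) (f : ℕ → ℤ) (k : ℕ) : Qf n f :=
  ∑ i ∈ Finset.range k, truncCoeff n f i * th n f ^ (k - i)

theorem hornerSum_succ (n : ℕ) (f : ℕ → ℤ) (k : ℕ) :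
    hornerSum n f (k + 1) = th n f * (hornerSum n f k + truncCoeff n f k) := by
  unfold hornerSum
  rw [Finset.sum_range_succ, mul_add, Finset.mul_sum]
  congr 1
  · refine Finset.sum_congr rfl fun i hi => ?_
    rw [Nat.succ_sub (Finset.mem_range.mp hi).le, pow_succ]
    ring
  · simp [mul_comm]

theorem hornerSum_add_coeff (n : ℕ) (f : ℕ → ℤ) :
    hornerSum n f n + truncCoeff n f n = 0 := by
  have h : AdjoinRoot.mk (fpoly n f) (∑ i ∈ Finset.range (n + 1),
      Polynomial.C (f i : ℚ) * Polynomial.X ^ (n - i)) = 0 := AdjoinRoot.mk_self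
  rw [map_sum, Finset.sum_range_succ] at h
  rw [← h]
  unfold hornerSum
  congr 1
  · refine Finset.sum_congr rfl fun i hi => ?_
    simp [truncCoeff, (Finset.mem_range.mp hi).le, th]
  · simp [truncCoeff]

theorem hornerSum_eq_zero (n : ℕ) (f : ℕ → ℤ) {k : ℕ} (hk : n < k) : hornerSum n f k = 0 := by
  induction k, hk using Nat.le_induction with
  | base => rw [hornerSum_succ, hornerSum_add_coeff, mul_zero]
  | succ k hk ih =>
    rw [hornerSum_succ, ih, truncCoeff, if_neg (by omega), add_zero, mul_zero]

theorem zeta_eq_hornerSum (n : ℕ) (f : ℕ → ℤ) {k : ℕ} (h1 : 1 ≤ k) (hk : k ≤ n) :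
    zeta n f k = hornerSum n f k := by
  rw [zeta, if_neg (by omega), hornerSum]
  refine Finset.sum_congr rfl fun i hi => ?_
  rw [truncCoeff, if_pos ((Finset.mem_range.mp hi).le.trans hk)]

theorem zetaExt_eq_hornerSum (n : ℕ) (f : ℕ → ℤ) {k : ℕ} (h1 : 1 ≤ k) (hk : k ≤ n) :
    zetaExt n f k = hornerSum n f k := by
  rw [zetaExt]
  split_ifs with h
  · subst h
    rw [eq_neg_of_add_eq_zero_left (hornerSum_add_coeff k f), truncCoeff, if_pos le_rfl]
  · exact zeta_eq_hornerSum n f h1 hk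

/-- Nakagawa's multiplication table: for `1 ≤ i ≤ j ≤ n-1`,
`ζ_i ζ_j = -∑_{max(i+j-n,1) ≤ k ≤ i} f_{i+j-k} ζ_k + ∑_{j < k ≤ min(i+j,n)} f_{i+j-k} ζ_k`,
where by convention `ζ_n := -f_n`. -/
theorem stmt0 (n : ℕ) (hn : 2 ≤ n) (f : ℕ → ℤ) (hf0 : f 0 ≠ 0)
    (i j : ℕ) (hi : 1 ≤ i) (hij : i ≤ j) (hj : j ≤ n - 1) :
    zeta n f i * zeta n f j =
      -(∑ k ∈ Finset.Icc (max (i + j - n) 1) i, (f (i + j - k) : Qf n f) * zetaExt n f k)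
      + ∑ k ∈ Finset.Icc (j + 1) (min (i + j) n), (f (i + j - k) : Qf n f) * zetaExt n f k := by
  rw [zeta_eq_hornerSum n f hi (by omega), zeta_eq_hornerSum n f (by omega : 1 ≤ j) (by omega),
    horner_mul_horner (th n f) (truncCoeff n f) (hornerSum n f) (by simp [hornerSum])
      (hornerSum_succ n f) i j]
  congr 1
  · congr 1
    symm
    refine Finset.sum_subset_zero_on_sdiff (fun k hk => ?_) (fun k hk => ?_) (fun k hk => ?_)
    · simp only [Finset.mem_Icc, Finset.mem_Ico] at hk ⊢
      omega
    · simp only [Finset.mem_sdiff, Finset.mem_Icc, Finset.mem_Ico] at hk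
      rw [truncCoeff, if_neg (by omega), zero_mul]
    · simp only [Finset.mem_Icc] at hk
      rw [truncCoeff, if_pos (by omega), zetaExt_eq_hornerSum n f (by omega) (by omega)]
  · symm
    refine Finset.sum_subset_zero_on_sdiff (fun k hk => ?_) (fun k hk => ?_) (fun k hk => ?_)
    · simp only [Finset.mem_Icc, Finset.mem_Ico] at hk ⊢
      omega
    · simp only [Finset.mem_sdiff, Finset.mem_Icc, Finset.mem_Ico] at hk
      rw [hornerSum_eq_zero n f (by omega), mul_zero]
    · simp only [Finset.mem_Icc] at hk
      rw [truncCoeff, if_pos (by omega), zetaExt_eq_hornerSum n f (by omega) (by omega)]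

end
end

section
/- The elements ζ_0, ζ_1, …, ζ_{n−1} of Q_f are linearly independent over ℚ (hence over ℤ), and the ℤ-submodule R_f that they span contains 1 and is closed under multiplication; consequently R_f is a subring of Q_f that is free of rank n as a ℤ-module. -/
open Polynomial

noncomputable section

/-- `R_f`, the ℤ-span of `ζ₀, …, ζ_(n-1)` in `Q_f`. -/
def Rf (n : ℕ) (f : ℕ → ℤ) : Submodule ℤ (Qf n f) :=
  Submodule.span ℤ (Set.range fun k : Fin n => zeta n f k)

/-- A sequence with `z₀ = 0` and `z_(k+1) = t (z_k + F_k)` that lies in a subgroup `M` has all its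
pairwise products in `M`. -/
theorem mul_mem_of_horner_recursion {A : Type*} [CommRing A] (M : Submodule ℤ A) (t : A)
    (F : ℕ → ℤ) (z : ℕ → A) (h0 : z 0 = 0) (hs : ∀ k, z (k + 1) = t * (z k + (F k : A)))
    (hM : ∀ k, z k ∈ M) (i j : ℕ) : z i * z j ∈ M := by
  induction i generalizing j with
  | zero => simp [h0]
  | succ i ih =>
    have h : z (i + 1) * z j = z i * z (j + 1) + F i • z (j + 1) - F j • z (i + 1) := by
      simp only [zsmul_eq_mul, hs]
      ring
    rw [h]
    exact M.sub_mem (M.add_mem (ih _) (M.smul_mem _ (hM _))) (M.smul_mem _ (hM _))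

/-- The partial sums `∑_{i<k} f_i θ^(k-i)`, with `f_i` replaced by `0` for `i > n`. -/
def partialSum (n : ℕ) (f : ℕ → ℤ) (k : ℕ) : Qf n f :=
  ∑ i ∈ Finset.range k, ((if i ≤ n then f i else 0 : ℤ) : Qf n f) * th n f ^ (k - i)

theorem partialSum_zero (n : ℕ) (f : ℕ → ℤ) : partialSum n f 0 = 0 := by
  simp [partialSum]

theorem partialSum_succ (n : ℕ) (f : ℕ → ℤ) (k : ℕ) :
    partialSum n f (k + 1) =
      th n f * (partialSum n f k + ((if k ≤ n then f k else 0 : ℤ) : Qf n f)) := by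
  rw [partialSum, Finset.sum_range_succ, mul_add, partialSum, Finset.mul_sum]
  congr 1
  · refine Finset.sum_congr rfl fun i hi => ?_
    rw [Nat.succ_sub (Finset.mem_range.1 hi).le, pow_succ]
    ring
  · simp [mul_comm]

theorem partialSum_eq_zeta {n k : ℕ} (f : ℕ → ℤ) (hk : k ≠ 0) (hkn : k < n) :
    partialSum n f k = zeta n f k := by
  rw [partialSum, zeta, if_neg hk]
  refine Finset.sum_congr rfl fun i hi => ?_
  rw [if_pos ((Finset.mem_range.1 hi).trans hkn).le]

theorem partialSum_self_add (n : ℕ) (f : ℕ → ℤ) : partialSum n f n + (f n : Qf n f) = 0 := by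
  have h : AdjoinRoot.mk (fpoly n f) (fpoly n f) = 0 := AdjoinRoot.mk_self
  conv_lhs at h => rw [show AdjoinRoot.mk (fpoly n f) (fpoly n f) =
    AdjoinRoot.mk (fpoly n f) (∑ i ∈ Finset.range (n + 1), C (f i : ℚ) * X ^ (n - i)) from rfl]
  rw [map_sum, Finset.sum_range_succ] at h
  rw [← h, partialSum]
  congr 1
  · refine Finset.sum_congr rfl fun i hi => ?_
    rw [if_pos (Finset.mem_range.1 hi).le]
    simp [th]
  · simp

theorem partialSum_of_lt {n k : ℕ} (f : ℕ → ℤ) (hk : n < k) : partialSum n f k = 0 := by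
  induction k, hk using Nat.le_induction with
  | base => rw [partialSum_succ, if_pos le_rfl, partialSum_self_add, mul_zero]
  | succ k hk ih => rw [partialSum_succ, ih, if_neg (by omega)]; simp

theorem zeta_mem_Rf {n k : ℕ} (f : ℕ → ℤ) (hk : k < n) : zeta n f k ∈ Rf n f :=
  Submodule.subset_span ⟨⟨k, hk⟩, rfl⟩

theorem one_mem_Rf {n : ℕ} (f : ℕ → ℤ) (hn : 0 < n) : (1 : Qf n f) ∈ Rf n f := by
  simpa [zeta] using zeta_mem_Rf f hn

theorem partialSum_mem_Rf {n : ℕ} (f : ℕ → ℤ) (hn : 0 < n) (k : ℕ) :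
    partialSum n f k ∈ Rf n f := by
  rcases eq_or_ne k 0 with rfl | hk
  · rw [partialSum_zero]
    exact zero_mem _
  rcases lt_trichotomy k n with h | rfl | h
  · rw [partialSum_eq_zeta f hk h]
    exact zeta_mem_Rf f h
  · rw [eq_neg_of_add_eq_zero_left (partialSum_self_add k f)]
    simpa using (Rf k f).neg_mem ((Rf k f).smul_mem (f k) (one_mem_Rf f hn))
  · rw [partialSum_of_lt f h]
    exact zero_mem _

theorem mul_mem_Rf {n : ℕ} (f : ℕ → ℤ) (hn : 0 < n) {x y : Qf n f} (hx : x ∈ Rf n f)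
    (hy : y ∈ Rf n f) : x * y ∈ Rf n f := by
  have key : ∀ i j : Fin n, zeta n f i * zeta n f j ∈ Rf n f := by
    intro i j
    by_cases hi : (i : ℕ) = 0
    · simpa [hi, zeta] using zeta_mem_Rf f j.2
    by_cases hj : (j : ℕ) = 0
    · simpa [hj, zeta] using zeta_mem_Rf f i.2
    rw [← partialSum_eq_zeta f hi i.2, ← partialSum_eq_zeta f hj j.2]
    exact mul_mem_of_horner_recursion _ _ _ _ (partialSum_zero n f) (partialSum_succ n f)
      (partialSum_mem_Rf f hn) _ _
  have hle : Rf n f * Rf n f ≤ Rf n f := by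
    conv_lhs => rw [Rf, Submodule.span_mul_span]
    rw [Submodule.span_le]
    rintro _ ⟨_, ⟨i, rfl⟩, _, ⟨j, rfl⟩, rfl⟩
    exact key i j
  exact hle (Submodule.mul_mem_mul hx hy)

theorem coeff_fpoly_self (n : ℕ) (f : ℕ → ℤ) : (fpoly n f).coeff n = f 0 := by
  rw [fpoly, finsetSum_coeff, Finset.sum_eq_single 0]
  · simp
  · intro i hi h0
    rw [coeff_C_mul_X_pow, if_neg]
    have := Finset.mem_range.1 hi
    omega
  · simp

theorem natDegree_fpoly (n : ℕ) {f : ℕ → ℤ} (hf0 : f 0 ≠ 0) : (fpoly n f).natDegree = n := by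
  refine natDegree_eq_of_le_of_coeff_ne_zero ?_ ?_
  · exact natDegree_sum_le_of_forall_le _ _ fun i _ =>
      (natDegree_C_mul_X_pow_le _ _).trans (Nat.sub_le _ _)
  · rw [coeff_fpoly_self]
    exact_mod_cast hf0

theorem fpoly_ne_zero (n : ℕ) {f : ℕ → ℤ} (hf0 : f 0 ≠ 0) : fpoly n f ≠ 0 := fun h =>
  hf0 (by simpa [h] using (coeff_fpoly_self n f).symm)

theorem span_zeta_eq_top {n : ℕ} (hn : 2 ≤ n) {f : ℕ → ℤ} (hf0 : f 0 ≠ 0) :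
    Submodule.span ℚ (Set.range fun k : Fin n => zeta n f k) = ⊤ := by
  set S := Submodule.span ℚ (Set.range fun k : Fin n => zeta n f k) with hS
  have hz : ∀ k < n, zeta n f k ∈ S := fun k hk => Submodule.subset_span ⟨⟨k, hk⟩, rfl⟩
  have hRS : ∀ x ∈ Rf n f, x ∈ S := fun x hx => Submodule.span_le_restrictScalars ℤ ℚ _ hx
  have hθ : th n f ∈ S := by
    have h1 : zeta n f 1 = (f 0 : ℚ) • th n f := by
      simp [zeta, Algebra.smul_def]
    have := S.smul_mem (f 0 : ℚ)⁻¹ (hz 1 (by omega))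
    rwa [h1, inv_smul_smul₀ (by exact_mod_cast hf0)] at this
  have hmul : ∀ x ∈ S, th n f * x ∈ S := by
    intro x hx
    induction hx using Submodule.span_induction with
    | mem x hx =>
      obtain ⟨k, rfl⟩ := hx
      by_cases hk : (k : ℕ) = 0
      · simpa [hk, zeta] using hθ
      · have h := partialSum_succ n f k
        rw [partialSum_eq_zeta f hk k.2, if_pos k.2.le, mul_add] at h
        have h2 : th n f * zeta n f k = partialSum n f (k + 1) - f k • th n f := by
          rw [h, zsmul_eq_mul]
          ring
        simp only [h2]
        exact S.sub_mem (hRS _ (partialSum_mem_Rf f (by omega) _)) (zsmul_mem hθ _)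
    | zero => simp
    | add x y _ _ hx hy => rw [mul_add]; exact S.add_mem hx hy
    | smul c x _ hx => rw [mul_smul_comm]; exact S.smul_mem c hx
  have hpow : ∀ k, th n f ^ k ∈ S := by
    intro k
    induction k with
    | zero => simpa [zeta] using hz 0 (by omega)
    | succ k ih => rw [pow_succ']; exact hmul _ ih
  rw [eq_top_iff, ← (AdjoinRoot.powerBasis (fpoly_ne_zero n hf0)).basis.span_eq,
    Submodule.span_le]
  rintro _ ⟨k, rfl⟩
  rw [PowerBasis.coe_basis]
  exact hpow k

theorem linearIndependent_zeta {n : ℕ} (hn : 2 ≤ n) {f : ℕ → ℤ} (hf0 : f 0 ≠ 0) :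
    LinearIndependent ℚ (fun k : Fin n => zeta n f k) := by
  refine linearIndependent_of_top_le_span_of_card_eq_finrank (span_zeta_eq_top hn hf0).ge ?_
  rw [(AdjoinRoot.powerBasis (fpoly_ne_zero n hf0)).finrank, AdjoinRoot.powerBasis_dim,
    natDegree_fpoly n hf0, Fintype.card_fin]

/-- `ζ₀, …, ζ_(n-1)` are linearly independent over `ℚ` (hence over `ℤ`), `R_f` contains `1`
and is closed under multiplication, and `R_f` is free of rank `n` as a ℤ-module. -/
theorem stmt1 (n : ℕ) (hn : 2 ≤ n) (f : ℕ → ℤ) (hf0 : f 0 ≠ 0) :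
    LinearIndependent ℚ (fun k : Fin n => zeta n f k) ∧
    LinearIndependent ℤ (fun k : Fin n => zeta n f k) ∧
    (1 : Qf n f) ∈ Rf n f ∧
    (∀ x ∈ Rf n f, ∀ y ∈ Rf n f, x * y ∈ Rf n f) ∧
    Module.Free ℤ (Rf n f) ∧
    Module.finrank ℤ (Rf n f) = n := by
  have hQ := linearIndependent_zeta hn hf0
  have hZ : LinearIndependent ℤ (fun k : Fin n => zeta n f k) :=
    hQ.restrict_scalars' ℤ
  refine ⟨hQ, hZ, one_mem_Rf f (by omega), fun x hx y hy => mul_mem_Rf f (by omega) hx hy,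
    Module.Free.of_basis (Module.Basis.span hZ), ?_⟩
  rw [Rf, finrank_span_eq_card hZ, Fintype.card_fin]

end
end

section
/- For every integer k ≥ 1 and every element r of R_f, the product r·θ^k lies in the ℤ-submodule of Q_f spanned by R_f together with the elements θ, θ², …, θ^k. -/
open Polynomial

noncomputable section

theorem sum_th_pow_eq_zero (n : ℕ) (f : ℕ → ℤ) :
    ∑ i ∈ Finset.range (n + 1), (f i : Qf n f) * th n f ^ (n - i) = 0 := by
  have h : (fpoly n f).eval₂ (AdjoinRoot.of (fpoly n f)) (th n f) = 0 := AdjoinRoot.eval₂_root _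
  have heval (φ : ℚ →+* Qf n f) : (fpoly n f).eval₂ φ (th n f) =
      ∑ i ∈ Finset.range (n + 1), (f i : Qf n f) * th n f ^ (n - i) := by
    simp only [fpoly, eval₂_finsetSum, eval₂_mul, eval₂_C, eval₂_X_pow]
    simp only [map_intCast]
  rw [← heval, h]

/-- The sum `f₀ θ^m + ⋯ + f_(m-1) θ`, which is `ζ_m` for `m ≥ 1` and `0` for `m = 0`. -/
def zetaSum (n : ℕ) (f : ℕ → ℤ) (m : ℕ) : Qf n f :=
  ∑ i ∈ Finset.range m, (f i : Qf n f) * th n f ^ (m - i)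

theorem zetaSum_mul_th (n : ℕ) (f : ℕ → ℤ) (m : ℕ) :
    zetaSum n f m * th n f = zetaSum n f (m + 1) - (f m : Qf n f) * th n f := by
  rw [zetaSum, zetaSum, Finset.sum_range_succ, Finset.sum_mul, Nat.add_sub_cancel_left, pow_one,
    add_sub_cancel_right]
  refine Finset.sum_congr rfl fun i hi => ?_
  rw [Nat.succ_sub (Finset.mem_range.mp hi).le, pow_succ, mul_assoc]

theorem zetaSum_self (n : ℕ) (f : ℕ → ℤ) : zetaSum n f n = -(f n : Qf n f) := by
  have h := sum_th_pow_eq_zero n f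
  rw [Finset.sum_range_succ, Nat.sub_self, pow_zero, mul_one] at h
  exact eq_neg_of_add_eq_zero_left h

theorem intCast_mem_Rf {n : ℕ} (hn : 0 < n) (f : ℕ → ℤ) (a : ℤ) : (a : Qf n f) ∈ Rf n f := by
  have h : (1 : Qf n f) ∈ Rf n f := Submodule.subset_span ⟨⟨0, hn⟩, by simp [zeta]⟩
  simpa using (Rf n f).smul_mem a h

theorem zetaSum_mem_Rf {n : ℕ} (hn : 0 < n) (f : ℕ → ℤ) {m : ℕ} (hm : m ≤ n) :
    zetaSum n f m ∈ Rf n f := by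
  rcases hm.eq_or_lt with rfl | hlt
  · rw [zetaSum_self, ← Int.cast_neg]
    exact intCast_mem_Rf hn f _
  · rcases Nat.eq_zero_or_pos m with rfl | hpos
    · simp [zetaSum]
    · exact Submodule.subset_span ⟨⟨m, hlt⟩, by simp [zeta, zetaSum, hpos.ne']⟩

/-- `R_f + ℤθ + ⋯ + ℤθ^k`. -/
def RfSupPow (n : ℕ) (f : ℕ → ℤ) (k : ℕ) : Submodule ℤ (Qf n f) :=
  Rf n f ⊔ Submodule.span ℤ ((fun j : ℕ => th n f ^ j) '' Set.Icc 1 k)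

theorem RfSupPow_mono (n : ℕ) (f : ℕ → ℤ) : Monotone (RfSupPow n f) := fun _ _ h =>
  sup_le_sup_left (Submodule.span_mono (Set.image_mono (Set.Icc_subset_Icc_right h))) _

theorem intCast_mul_th_pow_mem_RfSupPow (n : ℕ) (f : ℕ → ℤ) {k : ℕ} (hk : 1 ≤ k) (a : ℤ) :
    (a : Qf n f) * th n f ^ k ∈ RfSupPow n f k := by
  have h : th n f ^ k ∈ RfSupPow n f k :=
    Submodule.mem_sup_right (Submodule.subset_span ⟨k, ⟨hk, le_rfl⟩, rfl⟩)
  simpa using (RfSupPow n f k).smul_mem a h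

theorem zetaSum_mul_th_pow_mem_RfSupPow {n : ℕ} (hn : 0 < n) (f : ℕ → ℤ) (k : ℕ) {m : ℕ}
    (hm : m ≤ n) : zetaSum n f m * th n f ^ k ∈ RfSupPow n f k := by
  induction k generalizing m with
  | zero => simpa [RfSupPow] using zetaSum_mem_Rf hn f hm
  | succ k ih =>
    rcases hm.eq_or_lt with rfl | hlt
    · rw [zetaSum_self, ← Int.cast_neg]
      exact intCast_mul_th_pow_mem_RfSupPow m f k.succ_pos _
    · have h : zetaSum n f m * th n f ^ (k + 1) =
          zetaSum n f (m + 1) * th n f ^ k - (f m : Qf n f) * th n f ^ (k + 1) := by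
        linear_combination th n f ^ k * zetaSum_mul_th n f m
      rw [h]
      exact sub_mem (RfSupPow_mono n f k.le_succ (ih hlt))
        (intCast_mul_th_pow_mem_RfSupPow n f k.succ_pos _)

/-- For every `k ≥ 1` and every `r ∈ R_f`, the product `r θ^k` lies in the ℤ-submodule
spanned by `R_f` together with `θ, θ², …, θ^k`. -/
theorem stmt2 (n : ℕ) (hn : 2 ≤ n) (f : ℕ → ℤ) (hf0 : f 0 ≠ 0)
    (k : ℕ) (hk : 1 ≤ k) (r : Qf n f) (hr : r ∈ Rf n f) :
    r * th n f ^ k ∈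
      Rf n f ⊔ Submodule.span ℤ ((fun j : ℕ => th n f ^ j) '' Set.Icc 1 k) := by
  change r * th n f ^ k ∈ RfSupPow n f k
  induction hr using Submodule.span_induction with
  | mem x hx =>
    obtain ⟨⟨m, hm⟩, rfl⟩ := hx
    rcases Nat.eq_zero_or_pos m with rfl | hpos
    · simpa [zeta] using intCast_mul_th_pow_mem_RfSupPow n f hk 1
    · simpa [zeta, zetaSum, hpos.ne'] using
        zetaSum_mul_th_pow_mem_RfSupPow (by omega) f k hm.le
  | zero => simp
  | add x y _ _ hx hy => simpa only [add_mul] using add_mem hx hy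
  | smul a x _ hx => simpa only [smul_mul_assoc] using (RfSupPow n f k).smul_mem a hx

end
end

section
/- For all integers i, k with 1 ≤ i ≤ n−1 and k ≥ 1, the following identities hold in Q_f: if k + i ≤ n−1 then ζ_i θ^k = f_0 θ^{k+i} + f_1 θ^{k+i−1} + ⋯ + f_{i−1} θ^{k+1}; and if k + i ≥ n then ζ_i θ^k = −(f_i θ^k + f_{i+1} θ^{k−1} + ⋯ + f_n θ^{k+i−n}). -/
open Polynomial

noncomputable section

theorem sum_coeff_mul_th_pow_eq_zero (n : ℕ) (f : ℕ → ℤ) :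
    ∑ m ∈ Finset.range (n + 1), (f m : Qf n f) * th n f ^ (n - m) = 0 := by
  have h : AdjoinRoot.mk (fpoly n f)
      (∑ i ∈ Finset.range (n + 1), C (f i : ℚ) * X ^ (n - i)) = 0 := AdjoinRoot.mk_self
  simpa [th] using h

theorem zeta_mul_th_pow (n : ℕ) (f : ℕ → ℤ) {i : ℕ} (hi : 1 ≤ i) (k : ℕ) :
    zeta n f i * th n f ^ k =
      ∑ m ∈ Finset.range i, (f m : Qf n f) * th n f ^ (k + i - m) := by
  rw [zeta, if_neg (by omega), Finset.sum_mul]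
  refine Finset.sum_congr rfl fun m hm => ?_
  have hm := Finset.mem_range.mp hm
  rw [mul_assoc, ← pow_add, show i - m + k = k + i - m by omega]

theorem sum_coeff_mul_th_pow_shift_eq_zero (n : ℕ) (f : ℕ → ℤ) {d : ℕ} (hd : n ≤ d) :
    ∑ m ∈ Finset.range (n + 1), (f m : Qf n f) * th n f ^ (d - m) = 0 := by
  rw [← zero_mul (th n f ^ (d - n)), ← sum_coeff_mul_th_pow_eq_zero n f, Finset.sum_mul]
  refine Finset.sum_congr rfl fun m hm => ?_
  have hm := Finset.mem_range.mp hm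
  rw [mul_assoc, ← pow_add, show n - m + (d - n) = d - m by omega]

/-- For `1 ≤ i ≤ n-1` and `k ≥ 1`: if `k + i ≤ n - 1` then
`ζ_i θ^k = f₀ θ^(k+i) + f₁ θ^(k+i-1) + ⋯ + f_(i-1) θ^(k+1)`, and if `k + i ≥ n` then
`ζ_i θ^k = -(f_i θ^k + f_(i+1) θ^(k-1) + ⋯ + f_n θ^(k+i-n))`. -/
theorem stmt3 (n : ℕ) (hn : 2 ≤ n) (f : ℕ → ℤ) (hf0 : f 0 ≠ 0)
    (i k : ℕ) (hi1 : 1 ≤ i) (hi2 : i ≤ n - 1) (hk : 1 ≤ k) :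
    (k + i ≤ n - 1 →
      zeta n f i * th n f ^ k =
        ∑ m ∈ Finset.range i, (f m : Qf n f) * th n f ^ (k + i - m)) ∧
    (n ≤ k + i →
      zeta n f i * th n f ^ k =
        -(∑ m ∈ Finset.Icc i n, (f m : Qf n f) * th n f ^ (k + i - m))) := by
  refine ⟨fun _ => zeta_mul_th_pow n f hi1 k, fun h => ?_⟩
  rw [zeta_mul_th_pow n f hi1 k, eq_neg_iff_add_eq_zero, ← Finset.Ico_add_one_right_eq_Icc,
    Finset.sum_range_add_sum_Ico _ (by omega)]
  exact sum_coeff_mul_th_pow_shift_eq_zero n f h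

end
end

section
/- For every integer k with 1 ≤ k ≤ n−1, the submodule power I_f^k equals the ℤ-submodule of Q_f spanned by the n elements 1, θ, θ², …, θ^k, ζ_{k+1}, ζ_{k+2}, …, ζ_{n−1}, and these n elements are linearly independent over ℤ; in particular I_f^k is a free ℤ-module of rank n. -/
open Polynomial

noncomputable section

/-- `I_f^k`, the `k`-th power of the `R_f`-module `I_f = (1, θ)` under multiplication of
ℤ-submodules of `Q_f` (with `I_f^0 = R_f`). -/
def Ifpow (n : ℕ) (f : ℕ → ℤ) (k : ℕ) : Submodule ℤ (Qf n f) :=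
  Rf n f * (Submodule.span ℤ {1, th n f}) ^ k

theorem fpoly_degree (n : ℕ) (f : ℕ → ℤ) (hf0 : f 0 ≠ 0) : (fpoly n f).degree = n := by
  have hf : (f 0 : ℚ) ≠ 0 := by exact_mod_cast hf0
  rw [fpoly, Finset.sum_range_succ', Nat.sub_zero, degree_add_eq_right_of_degree_lt]
  · exact degree_C_mul_X_pow n hf
  · rw [degree_C_mul_X_pow n hf]
    refine (degree_sum_le _ _).trans_lt ((Finset.sup_lt_iff (WithBot.bot_lt_coe n)).2 ?_)
    intro i hi
    have hi := Finset.mem_range.1 hi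
    refine (degree_C_mul_X_pow_le _ _).trans_lt ?_
    exact WithBot.coe_lt_coe.2 (by omega : n - (i + 1) < n)

/-- A polynomial lift of the `i`-th basis element of `I_f^k`. -/
def basisPoly (f : ℕ → ℤ) (k i : ℕ) : ℚ[X] :=
  if i ≤ k then X ^ i else ∑ j ∈ Finset.range i, C (f j : ℚ) * X ^ (i - j)

theorem basisPoly_degree (f : ℕ → ℤ) (hf0 : f 0 ≠ 0) (k i : ℕ) :
    (basisPoly f k i).degree = i := by
  unfold basisPoly
  split_ifs with h
  · exact degree_X_pow i
  · have hf : (f 0 : ℚ) ≠ 0 := by exact_mod_cast hf0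
    obtain ⟨m, rfl⟩ : ∃ m, i = m + 1 := ⟨i - 1, by omega⟩
    rw [Finset.sum_range_succ', Nat.sub_zero, degree_add_eq_right_of_degree_lt]
    · exact degree_C_mul_X_pow _ hf
    · rw [degree_C_mul_X_pow _ hf]
      refine (degree_sum_le _ _).trans_lt ((Finset.sup_lt_iff (WithBot.bot_lt_coe _)).2 ?_)
      intro j hj
      refine (degree_C_mul_X_pow_le _ _).trans_lt ?_
      exact WithBot.coe_lt_coe.2 (by omega : m + 1 - (j + 1) < m + 1)

/-- The `i`-th basis element of `I_f^k`. -/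
def basisElem (n : ℕ) (f : ℕ → ℤ) (k i : ℕ) : Qf n f :=
  if i ≤ k then th n f ^ i else zeta n f i

theorem mk_basisPoly (n : ℕ) (f : ℕ → ℤ) (k i : ℕ) :
    AdjoinRoot.mk (fpoly n f) (basisPoly f k i) = basisElem n f k i := by
  unfold basisPoly basisElem zeta th
  split_ifs with h h0
  · simp
  · omega
  · simp

theorem linearIndependent_basisElem (n : ℕ) (f : ℕ → ℤ) (hf0 : f 0 ≠ 0) (k : ℕ) :
    LinearIndependent ℤ (fun i : Fin n => basisElem n f k i) := by
  let S : Polynomial.Sequence ℚ := ⟨basisPoly f k, basisPoly_degree f hf0 k⟩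
  have hS : LinearIndependent ℚ (fun i : Fin n => basisPoly f k i) :=
    S.linearIndependent.comp _ Fin.val_injective
  have hQ : LinearIndependent ℚ (fun i : Fin n => basisElem n f k i) := by
    have := hS.map (f := (AdjoinRoot.mkₐ (R := ℚ) (fpoly n f)).toLinearMap) ?_
    · rwa [show ⇑(AdjoinRoot.mkₐ (R := ℚ) (fpoly n f)).toLinearMap ∘
          (fun i : Fin n => basisPoly f k i) = fun i : Fin n => basisElem n f k i from
        funext fun i => mk_basisPoly n f k i] at this
    · rw [Submodule.disjoint_def]
      intro q hq hker
      have hdeg : q ∈ degreeLT ℚ n := by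
        refine Submodule.span_le.2 ?_ hq
        rintro _ ⟨i, rfl⟩
        rw [SetLike.mem_coe, mem_degreeLT, basisPoly_degree f hf0]
        exact_mod_cast i.2
      have hdvd : fpoly n f ∣ q := AdjoinRoot.mk_eq_zero.1 hker
      refine eq_zero_of_dvd_of_degree_lt hdvd ?_
      rw [fpoly_degree n f hf0]
      exact mem_degreeLT.1 hdeg
  exact hQ.restrict_scalars (by
    intro a b h
    simpa using h)

/-- The `ℤ`-span of the first `n` basis elements. -/
def basisSpan (n : ℕ) (f : ℕ → ℤ) (k : ℕ) : Submodule ℤ (Qf n f) :=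
  Submodule.span ℤ (Set.range fun i : Fin n => basisElem n f k i)

theorem basisElem_mem (n : ℕ) (f : ℕ → ℤ) (k i : ℕ) (hi : i < n) :
    basisElem n f k i ∈ basisSpan n f k :=
  Submodule.subset_span ⟨⟨i, hi⟩, rfl⟩

theorem th_pow_mem (n : ℕ) (f : ℕ → ℤ) (k i : ℕ) (hi : i < n) (hik : i ≤ k) :
    th n f ^ i ∈ basisSpan n f k := by
  simpa [basisElem, hik] using basisElem_mem n f k i hi

theorem intCast_mul_mem {A : Type*} [CommRing A] (M : Submodule ℤ A) (a : ℤ) {x : A}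
    (hx : x ∈ M) : (a : A) * x ∈ M := by
  rw [← zsmul_eq_mul]
  exact M.smul_mem a hx

theorem zeta_mem (n : ℕ) (f : ℕ → ℤ) (k i : ℕ) (hi : i < n) :
    zeta n f i ∈ basisSpan n f k := by
  by_cases hik : i ≤ k
  · unfold zeta
    split_ifs with h0
    · simpa using th_pow_mem n f k 0 (by omega) (by omega)
    · exact Submodule.sum_mem _ fun j _ =>
        intCast_mul_mem _ _ (th_pow_mem n f k (i - j) (by omega) (by omega))
  · simpa [basisElem, hik] using basisElem_mem n f k i hi

theorem th_mul_zeta (n : ℕ) (f : ℕ → ℤ) (i : ℕ) (hi : i ≠ 0) :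
    th n f * zeta n f i = zeta n f (i + 1) - (f i : Qf n f) * th n f := by
  simp only [zeta, hi, if_false, Nat.succ_ne_zero, Finset.sum_range_succ, Finset.mul_sum]
  rw [show i + 1 - i = 1 by omega, pow_one, add_sub_cancel_right]
  refine Finset.sum_congr rfl fun j hj => ?_
  have := Finset.mem_range.1 hj
  rw [show i + 1 - j = (i - j) + 1 by omega]
  ring

theorem zeta_top (n : ℕ) (f : ℕ → ℤ) (hn : n ≠ 0) : zeta n f n = -(f n : Qf n f) := by
  have h : AdjoinRoot.mk (fpoly n f) (fpoly n f) = 0 := AdjoinRoot.mk_self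
  conv_lhs at h => arg 2; rw [fpoly]
  rw [Finset.sum_range_succ] at h
  simp only [map_add, map_sum, map_mul, map_pow, AdjoinRoot.mk_X, map_intCast,
    Nat.sub_self, pow_zero, mul_one] at h
  rw [zeta, if_neg hn]
  exact eq_neg_of_add_eq_zero_left h

theorem basisSpan_zero (n : ℕ) (f : ℕ → ℤ) : basisSpan n f 0 = Rf n f := by
  unfold basisSpan Rf
  congr 2
  funext i
  by_cases h : (i : ℕ) = 0 <;> simp [basisElem, zeta, h]

theorem basisSpan_mul (n : ℕ) (f : ℕ → ℤ) (k : ℕ) (hk : k + 1 < n) :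
    basisSpan n f k * Submodule.span ℤ {1, th n f} = basisSpan n f (k + 1) := by
  have h1 : (1 : Qf n f) ∈ Submodule.span ℤ {1, th n f} := Submodule.subset_span (by simp)
  have hth : th n f ∈ Submodule.span ℤ {1, th n f} := Submodule.subset_span (by simp)
  have h1' : (1 : Qf n f) ∈ basisSpan n f (k + 1) := by
    simpa using th_pow_mem n f (k + 1) 0 (by omega) (by omega)
  have hth' : th n f ∈ basisSpan n f (k + 1) := by
    simpa using th_pow_mem n f (k + 1) 1 (by omega) (by omega)
  apply le_antisymm
  · rw [basisSpan, Submodule.span_mul_span, Submodule.span_le]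
    rintro _ ⟨_, ⟨⟨i, hi⟩, rfl⟩, y, hy, rfl⟩
    simp only [SetLike.mem_coe, basisElem]
    rcases hy with rfl | hy
    · rw [mul_one]
      split_ifs with hik
      · exact th_pow_mem _ _ _ _ hi (by omega)
      · exact zeta_mem _ _ _ _ hi
    · rw [Set.mem_singleton_iff.1 hy]
      split_ifs with hik
      · rw [← pow_succ]
        exact th_pow_mem _ _ _ _ (by omega) (by omega)
      · rw [mul_comm, th_mul_zeta _ _ _ (by omega)]
        refine Submodule.sub_mem _ ?_ (intCast_mul_mem _ _ hth')
        by_cases hin : i + 1 < n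
        · exact zeta_mem _ _ _ _ hin
        · rw [show i + 1 = n by omega, zeta_top _ _ (by omega)]
          simpa using Submodule.neg_mem _ (intCast_mul_mem _ (f n) h1')
  · rw [basisSpan, Submodule.span_le]
    rintro _ ⟨⟨i, hi⟩, rfl⟩
    simp only [SetLike.mem_coe, basisElem]
    split_ifs with hik
    · by_cases h : i ≤ k
      · simpa using Submodule.mul_mem_mul (th_pow_mem n f k i hi h) h1
      · rw [show i = k + 1 by omega, pow_succ]
        exact Submodule.mul_mem_mul (th_pow_mem n f k k (by omega) le_rfl) hth
    · simpa using Submodule.mul_mem_mul (zeta_mem n f k i hi) h1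

theorem Ifpow_eq_basisSpan (n : ℕ) (f : ℕ → ℤ) (k : ℕ) (hk : k < n) :
    Ifpow n f k = basisSpan n f k := by
  induction k with
  | zero => rw [Ifpow, pow_zero, mul_one, basisSpan_zero]
  | succ k ih =>
    rw [← basisSpan_mul n f k hk, ← ih (by omega), Ifpow, Ifpow, pow_succ, mul_assoc]

/-- For `1 ≤ k ≤ n-1`, `I_f^k` is the ℤ-span of the `n` elements
`1, θ, …, θ^k, ζ_(k+1), …, ζ_(n-1)`, which are linearly independent over `ℤ`;
in particular `I_f^k` is a free ℤ-module of rank `n`. -/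
theorem stmt4 (n : ℕ) (hn : 2 ≤ n) (f : ℕ → ℤ) (hf0 : f 0 ≠ 0)
    (k : ℕ) (hk1 : 1 ≤ k) (hk2 : k ≤ n - 1) :
    Ifpow n f k =
      Submodule.span ℤ (Set.range fun i : Fin n =>
        if (i : ℕ) ≤ k then th n f ^ (i : ℕ) else zeta n f i) ∧
    LinearIndependent ℤ (fun i : Fin n =>
        if (i : ℕ) ≤ k then th n f ^ (i : ℕ) else zeta n f i) ∧
    Module.Free ℤ (Ifpow n f k) ∧
    Module.finrank ℤ (Ifpow n f k) = n := by
  have hI := Ifpow_eq_basisSpan n f k (by omega)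
  have hli := linearIndependent_basisElem n f hf0 k
  refine ⟨hI, hli, ?_, ?_⟩
  · rw [hI]
    exact Module.Free.of_basis (Module.Basis.span hli)
  · rw [hI]
    exact (finrank_span_eq_card hli).trans (Fintype.card_fin n)

end
end
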